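/- Each reduction step preserves the class of knot Eulerian graphs: after deleting an empty vertex and merging its two edges (Step 1), after performing an RI⁻ move at a real vertex carrying a loop edge (u, u, A, B) or (u, u, B, A) (Step 2), or after unifying two unifiable real vertices (Step 3), the resulting directed labeled multigraph is again a knot Eulerian graph, i.e., every real vertex still has exactly two incoming and two outgoing edges with side labels A and B, every empty vertex has exactly one incoming and one outgoing edge labeled None, and every edge carries a consistent tuple (u, v, T_u, T_v). -/

import Mathlib

/-- The side label of an edge-end at a vertex: side `A` or `B` of the axis of a
real vertex, or `N` (= "None") at an empty vertex. -/
inductive KSide : Type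
  | A | B | N
  deriving DecidableEq

/-- A finite directed labeled multigraph: the raw data underlying a knot
Eulerian graph.  Each edge `e` is the tuple `(src e, tgt e, sSide e, tSide e)`;
each vertex is a real vertex (`real v = true`, with parity label `parity v`)
or an empty vertex (`real v = false`). -/
structure PreKEG where
  V : Type
  E : Type
  [fintypeV : Fintype V]
  [decEqV : DecidableEq V]
  [fintypeE : Fintype E]
  [decEqE : DecidableEq E]
  src : E → V
  tgt : E → V
  sSide : E → KSide
  tSide : E → KSide
  real : V → Bool
  parity : V → Bool

attribute [instance] PreKEG.fintypeV PreKEG.decEqV PreKEG.fintypeE PreKEG.decEqE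

namespace PreKEG

/-- Number of outgoing edges at `v`. -/
def outCard (G : PreKEG) (v : G.V) : ℕ :=
  (Finset.univ.filter (fun e => G.src e = v)).card

/-- Number of incoming edges at `v`. -/
def inCard (G : PreKEG) (v : G.V) : ℕ :=
  (Finset.univ.filter (fun e => G.tgt e = v)).card

/-- Total degree of `v` (incoming plus outgoing edge-ends; a loop counts twice). -/
def degree (G : PreKEG) (v : G.V) : ℕ := G.inCard v + G.outCard v

/-- Number of edge-ends at `v` labeled with side `s`. -/
def sideCard (G : PreKEG) (v : G.V) (s : KSide) : ℕ :=
  (Finset.univ.filter (fun e => G.src e = v ∧ G.sSide e = s)).card +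
  (Finset.univ.filter (fun e => G.tgt e = v ∧ G.tSide e = s)).card

/-- `G` is a knot Eulerian graph: every real vertex has exactly two incoming and
two outgoing edges, with exactly two edge-ends on each of its sides `A` and `B`;
every empty vertex has exactly one incoming and one outgoing edge; and an
edge-end is labeled `N` ("None") exactly when the corresponding vertex is empty. -/
def IsKEG (G : PreKEG) : Prop :=
  (∀ v, G.real v = true →
    G.inCard v = 2 ∧ G.outCard v = 2 ∧
    G.sideCard v KSide.A = 2 ∧ G.sideCard v KSide.B = 2) ∧
  (∀ v, G.real v = false → G.inCard v = 1 ∧ G.outCard v = 1) ∧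
  (∀ e, (G.sSide e = KSide.N ↔ G.real (G.src e) = false) ∧
        (G.tSide e = KSide.N ↔ G.real (G.tgt e) = false))

/-- Label-preserving isomorphism of directed labeled multigraphs. -/
structure Iso (G H : PreKEG) where
  vEquiv : G.V ≃ H.V
  eEquiv : G.E ≃ H.E
  map_src : ∀ e, H.src (eEquiv e) = vEquiv (G.src e)
  map_tgt : ∀ e, H.tgt (eEquiv e) = vEquiv (G.tgt e)
  map_sSide : ∀ e, H.sSide (eEquiv e) = G.sSide e
  map_tSide : ∀ e, H.tSide (eEquiv e) = G.tSide e
  map_real : ∀ v, H.real (vEquiv v) = G.real v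
  map_parity : ∀ v, H.parity (vEquiv v) = G.parity v

/-- Data witnessing that `H` is obtained from `G` by Step 1: deleting the empty
vertex `w`, whose incoming edge `eIn = (a, w, T_a, N)` and outgoing edge
`eOut = (w, b, N, T_b)` are merged into the single new edge `(a, b, T_a, T_b)`;
all other vertices and edges, with their labels, are kept. -/
structure Step1Data (G H : PreKEG) where
  w : G.V
  hw : G.real w = false
  eIn : G.E
  eOut : G.E
  hIn : G.tgt eIn = w
  hOut : G.src eOut = w
  hne : eIn ≠ eOut
  hsrcIn : G.src eIn ≠ w
  htgtOut : G.tgt eOut ≠ w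
  φ : {v : G.V // v ≠ w} ≃ H.V
  ψ : {e : G.E // e ≠ eIn ∧ e ≠ eOut} ⊕ Unit ≃ H.E
  map_real : ∀ v : {v : G.V // v ≠ w}, H.real (φ v) = G.real v.1
  map_parity : ∀ v : {v : G.V // v ≠ w}, H.parity (φ v) = G.parity v.1
  surv_src : ∀ (e : {e : G.E // e ≠ eIn ∧ e ≠ eOut}) (h : G.src e.1 ≠ w),
    H.src (ψ (Sum.inl e)) = φ ⟨G.src e.1, h⟩
  surv_tgt : ∀ (e : {e : G.E // e ≠ eIn ∧ e ≠ eOut}) (h : G.tgt e.1 ≠ w),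
    H.tgt (ψ (Sum.inl e)) = φ ⟨G.tgt e.1, h⟩
  surv_sSide : ∀ e : {e : G.E // e ≠ eIn ∧ e ≠ eOut},
    H.sSide (ψ (Sum.inl e)) = G.sSide e.1
  surv_tSide : ∀ e : {e : G.E // e ≠ eIn ∧ e ≠ eOut},
    H.tSide (ψ (Sum.inl e)) = G.tSide e.1
  new_src : H.src (ψ (Sum.inr ())) = φ ⟨G.src eIn, hsrcIn⟩
  new_tgt : H.tgt (ψ (Sum.inr ())) = φ ⟨G.tgt eOut, htgtOut⟩
  new_sSide : H.sSide (ψ (Sum.inr ())) = G.sSide eIn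
  new_tSide : H.tSide (ψ (Sum.inr ())) = G.tSide eOut

/-- Data witnessing that `H` is obtained from `G` by Step 2 (an `RI⁻` move):
the real vertex `u` carries a loop `(u, u, A, B)` (resp. `(u, u, B, A)`);
the vertex `u`, the loop, and the two other edges `(a, u, T_a, B)` and
`(u, b, A, T_b)` (resp. `(a, u, T_a, A)` and `(u, b, B, T_b)`) at `u` are
removed, the latter two being replaced by the single new edge `(a, b, T_a, T_b)`;
all other vertices and edges, with their labels, are kept. -/
structure Step2Data (G H : PreKEG) where
  u : G.V
  hu : G.real u = true
  loop : G.E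
  hloopSrc : G.src loop = u
  hloopTgt : G.tgt loop = u
  hloopSide : (G.sSide loop = KSide.A ∧ G.tSide loop = KSide.B) ∨
              (G.sSide loop = KSide.B ∧ G.tSide loop = KSide.A)
  eIn : G.E
  eOut : G.E
  hIn : G.tgt eIn = u
  hInSide : G.tSide eIn = G.tSide loop
  hOut : G.src eOut = u
  hOutSide : G.sSide eOut = G.sSide loop
  hsrcIn : G.src eIn ≠ u
  htgtOut : G.tgt eOut ≠ u
  φ : {v : G.V // v ≠ u} ≃ H.V
  ψ : {e : G.E // e ≠ loop ∧ e ≠ eIn ∧ e ≠ eOut} ⊕ Unit ≃ H.E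
  map_real : ∀ v : {v : G.V // v ≠ u}, H.real (φ v) = G.real v.1
  map_parity : ∀ v : {v : G.V // v ≠ u}, H.parity (φ v) = G.parity v.1
  surv_src : ∀ (e : {e : G.E // e ≠ loop ∧ e ≠ eIn ∧ e ≠ eOut}) (h : G.src e.1 ≠ u),
    H.src (ψ (Sum.inl e)) = φ ⟨G.src e.1, h⟩
  surv_tgt : ∀ (e : {e : G.E // e ≠ loop ∧ e ≠ eIn ∧ e ≠ eOut}) (h : G.tgt e.1 ≠ u),
    H.tgt (ψ (Sum.inl e)) = φ ⟨G.tgt e.1, h⟩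
  surv_sSide : ∀ e : {e : G.E // e ≠ loop ∧ e ≠ eIn ∧ e ≠ eOut},
    H.sSide (ψ (Sum.inl e)) = G.sSide e.1
  surv_tSide : ∀ e : {e : G.E // e ≠ loop ∧ e ≠ eIn ∧ e ≠ eOut},
    H.tSide (ψ (Sum.inl e)) = G.tSide e.1
  new_src : H.src (ψ (Sum.inr ())) = φ ⟨G.src eIn, hsrcIn⟩
  new_tgt : H.tgt (ψ (Sum.inr ())) = φ ⟨G.tgt eOut, htgtOut⟩
  new_sSide : H.sSide (ψ (Sum.inr ())) = G.sSide eIn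
  new_tSide : H.tSide (ψ (Sum.inr ())) = G.tSide eOut

/-- The edge `e` joins the vertices `u` and `v` (in either direction), its end at
`u` lying on side `su` of `u` and its end at `v` lying on side `sv` of `v`. -/
def Joins (G : PreKEG) (e : G.E) (u v : G.V) (su sv : KSide) : Prop :=
  (G.src e = u ∧ G.tgt e = v ∧ G.sSide e = su ∧ G.tSide e = sv) ∨
  (G.src e = v ∧ G.tgt e = u ∧ G.sSide e = sv ∧ G.tSide e = su)

/-- Data witnessing that `H` is obtained from `G` by Step 3: the two adjacent
real vertices `u` and `v`, joined along the full side `su` of `u` and the full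
side `sv` of `v` by the two edges `d₁, d₂` (a digon of a common twisted region),
are unified into a single new real vertex whose parity is odd iff exactly one of
the parities of `u` and `v` is odd; the edges `d₁, d₂` are deleted, the remaining
edge-ends at `u` (resp. at `v`) are reattached to the new vertex on its side `A`
(resp. `B`), and everything else is kept. -/
structure Step3Data (G H : PreKEG) where
  u : G.V
  v : G.V
  hu : G.real u = true
  hv : G.real v = true
  huv : u ≠ v
  su : KSide
  sv : KSide
  hsu : su = KSide.A ∨ su = KSide.B
  hsv : sv = KSide.A ∨ sv = KSide.B
  d₁ : G.E
  d₂ : G.E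
  hd : d₁ ≠ d₂
  hj₁ : G.Joins d₁ u v su sv
  hj₂ : G.Joins d₂ u v su sv
  φ : {x : G.V // x ≠ u ∧ x ≠ v} ⊕ Unit ≃ H.V
  ψ : {e : G.E // e ≠ d₁ ∧ e ≠ d₂} ≃ H.E
  map_real : ∀ x : {x : G.V // x ≠ u ∧ x ≠ v}, H.real (φ (Sum.inl x)) = G.real x.1
  map_parity : ∀ x : {x : G.V // x ≠ u ∧ x ≠ v}, H.parity (φ (Sum.inl x)) = G.parity x.1
  new_real : H.real (φ (Sum.inr ())) = true
  new_parity : H.parity (φ (Sum.inr ())) = xor (G.parity u) (G.parity v)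
  surv_src : ∀ (e : {e : G.E // e ≠ d₁ ∧ e ≠ d₂}) (h1 : G.src e.1 ≠ u) (h2 : G.src e.1 ≠ v),
    H.src (ψ e) = φ (Sum.inl ⟨G.src e.1, h1, h2⟩) ∧ H.sSide (ψ e) = G.sSide e.1
  surv_tgt : ∀ (e : {e : G.E // e ≠ d₁ ∧ e ≠ d₂}) (h1 : G.tgt e.1 ≠ u) (h2 : G.tgt e.1 ≠ v),
    H.tgt (ψ e) = φ (Sum.inl ⟨G.tgt e.1, h1, h2⟩) ∧ H.tSide (ψ e) = G.tSide e.1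
  src_u : ∀ e : {e : G.E // e ≠ d₁ ∧ e ≠ d₂}, G.src e.1 = u →
    H.src (ψ e) = φ (Sum.inr ()) ∧ H.sSide (ψ e) = KSide.A
  src_v : ∀ e : {e : G.E // e ≠ d₁ ∧ e ≠ d₂}, G.src e.1 = v →
    H.src (ψ e) = φ (Sum.inr ()) ∧ H.sSide (ψ e) = KSide.B
  tgt_u : ∀ e : {e : G.E // e ≠ d₁ ∧ e ≠ d₂}, G.tgt e.1 = u →
    H.tgt (ψ e) = φ (Sum.inr ()) ∧ H.tSide (ψ e) = KSide.A
  tgt_v : ∀ e : {e : G.E // e ≠ d₁ ∧ e ≠ d₂}, G.tgt e.1 = v →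
    H.tgt (ψ e) = φ (Sum.inr ()) ∧ H.tSide (ψ e) = KSide.B

/-- `H` is obtained from `G` by a single reduction step (Step 1, Step 2 or Step 3). -/
def Step (G H : PreKEG) : Prop :=
  Nonempty (Step1Data G H) ∨ Nonempty (Step2Data G H) ∨ Nonempty (Step3Data G H)

/-- `G` is reduced: no Step 1, Step 2 or Step 3 move applies to it. -/
def Reduced (G : PreKEG) : Prop := ∀ H : PreKEG, ¬ G.Step H

/-- Counting along a bijection that keeps the elements satisfying `S` and replaces one further
element `e₀` by a new one. -/
theorem card_filter_merge {E E' : Type*} [Fintype E] [Fintype E'] {S : E → Prop}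
    (ψ : {e : E // S e} ⊕ Unit ≃ E') {e₀ : E} (h₀ : ¬ S e₀) {p : E → Prop} {q : E' → Prop}
    [DecidablePred p] [DecidablePred q] (hp : ∀ e, p e → S e ∨ e = e₀)
    (hq : ∀ e, q (ψ (Sum.inl e)) ↔ p e.1) (hq₀ : q (ψ (Sum.inr ())) ↔ p e₀) :
    (Finset.univ.filter q).card = (Finset.univ.filter p).card := by
  symm
  classical
  refine Finset.card_bij
    (fun e _ => if h : S e then ψ (Sum.inl ⟨e, h⟩) else ψ (Sum.inr ())) ?_ ?_ ?_
  · intro e he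
    simp only [Finset.mem_filter, Finset.mem_univ, true_and] at he ⊢
    split_ifs with h
    · exact (hq ⟨e, h⟩).2 he
    · obtain rfl := (hp e he).resolve_left h
      exact hq₀.2 he
  · intro a ha b hb hab
    simp only [Finset.mem_filter, Finset.mem_univ, true_and] at ha hb
    split_ifs at hab with h h' h'
    · simpa using hab
    · simp at hab
    · simp at hab
    · exact ((hp a ha).resolve_left h).trans ((hp b hb).resolve_left h').symm
  · intro b hb
    simp only [Finset.mem_filter, Finset.mem_univ, true_and] at hb
    obtain ⟨x, rfl⟩ := ψ.surjective b
    rcases x with e | ⟨⟩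
    · exact ⟨e.1, by simpa using (hq e).1 hb, by simp [e.2]⟩
    · exact ⟨e₀, by simpa using hq₀.1 hb, by simp [h₀]⟩

/-- Counting along a bijection that removes two elements. -/
theorem card_filter_remove_two {E E' : Type*} [Fintype E] [DecidableEq E] [Fintype E']
    {d₁ d₂ : E} (hd : d₁ ≠ d₂) (ψ : {e : E // e ≠ d₁ ∧ e ≠ d₂} ≃ E')
    {p : E → Prop} {q : E' → Prop} [DecidablePred p] [DecidablePred q]
    (hq : ∀ e, q (ψ e) ↔ p e.1) :
    (Finset.univ.filter q).card + ((if p d₁ then 1 else 0) + (if p d₂ then 1 else 0)) =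
      (Finset.univ.filter p).card := by
  have hcard : (Finset.univ.filter q).card =
      (Finset.univ.filter fun e => p e ∧ ¬ (e = d₁ ∨ e = d₂)).card := by
    symm
    refine Finset.card_bij (fun e he => ψ ⟨e, by simpa using (Finset.mem_filter.1 he).2.2⟩)
      ?_ ?_ ?_
    · intro e he
      simpa [hq] using (Finset.mem_filter.1 he).2.1
    · intro a _ b _ hab
      simpa using hab
    · intro b hb
      obtain ⟨e, rfl⟩ := ψ.surjective b
      have := e.2
      exact ⟨e.1, by simpa [this] using (hq e).1 (by simpa using hb), rfl⟩
  have hrest : (if p d₁ then 1 else 0) + (if p d₂ then 1 else 0) =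
      (Finset.univ.filter fun e => p e ∧ (e = d₁ ∨ e = d₂)).card := by
    have : (Finset.univ.filter fun e => p e ∧ (e = d₁ ∨ e = d₂)) =
        ({d₁, d₂} : Finset E).filter p := by
      ext e
      simp [and_comm]
    rw [this, Finset.card_filter, Finset.sum_pair hd]
  rw [hcard, hrest, add_comm, ← Finset.filter_filter, ← Finset.filter_filter]
  exact Finset.card_filter_add_card_filter_not _

theorem eq_of_card_filter_eq_one {E : Type*} [Fintype E] {p : E → Prop} [DecidablePred p]
    (h : (Finset.univ.filter p).card = 1) {a e : E} (ha : p a) (he : p e) : e = a :=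
  Finset.card_le_one.1 h.le e (by simpa using he) a (by simpa using ha)

theorem eq_or_eq_of_card_filter_eq_two {E : Type*} [Fintype E] [DecidableEq E] {p : E → Prop}
    [DecidablePred p] (h : (Finset.univ.filter p).card = 2) {a b e : E} (hab : a ≠ b)
    (ha : p a) (hb : p b) (he : p e) : e = a ∨ e = b := by
  have hsub : ({a, b} : Finset E) ⊆ Finset.univ.filter p := by
    intro x hx
    simp only [Finset.mem_insert, Finset.mem_singleton] at hx
    rcases hx with rfl | rfl <;> simpa
  have heq := Finset.eq_of_subset_of_card_le hsub (by rw [h, Finset.card_pair hab])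
  have : e ∈ ({a, b} : Finset E) := heq ▸ by simpa using he
  simpa using this

/-- Deleting a vertex `w` and merging an edge `eIn` into `w` with an edge `eOut` out of `w`
preserves knot Eulerian graphs, provided that the kept edges are those not incident to `w`. -/
theorem isKEG_of_merge {G H : PreKEG} (hG : G.IsKEG) {w : G.V} {S : G.E → Prop} {eIn eOut : G.E}
    (hS_in : ¬ S eIn) (hS_out : ¬ S eOut)
    (hsrc : ∀ e, G.src e ≠ w ↔ S e ∨ e = eIn) (htgt : ∀ e, G.tgt e ≠ w ↔ S e ∨ e = eOut)
    (φ : {v : G.V // v ≠ w} ≃ H.V) (ψ : {e : G.E // S e} ⊕ Unit ≃ H.E)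
    (map_real : ∀ v, H.real (φ v) = G.real v.1)
    (surv_src : ∀ (e : {e : G.E // S e}) (h : G.src e.1 ≠ w),
      H.src (ψ (Sum.inl e)) = φ ⟨G.src e.1, h⟩)
    (surv_tgt : ∀ (e : {e : G.E // S e}) (h : G.tgt e.1 ≠ w),
      H.tgt (ψ (Sum.inl e)) = φ ⟨G.tgt e.1, h⟩)
    (surv_sSide : ∀ e, H.sSide (ψ (Sum.inl e)) = G.sSide e.1)
    (surv_tSide : ∀ e, H.tSide (ψ (Sum.inl e)) = G.tSide e.1)
    (new_src : ∀ h : G.src eIn ≠ w, H.src (ψ (Sum.inr ())) = φ ⟨G.src eIn, h⟩)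
    (new_tgt : ∀ h : G.tgt eOut ≠ w, H.tgt (ψ (Sum.inr ())) = φ ⟨G.tgt eOut, h⟩)
    (new_sSide : H.sSide (ψ (Sum.inr ())) = G.sSide eIn)
    (new_tSide : H.tSide (ψ (Sum.inr ())) = G.tSide eOut) : H.IsKEG := by
  have src_surv : ∀ (e : {e : G.E // S e}) x, H.src (ψ (Sum.inl e)) = φ x ↔ G.src e.1 = x := by
    intro e x
    rw [surv_src e ((hsrc _).2 (Or.inl e.2)), φ.apply_eq_iff_eq, Subtype.ext_iff]
  have tgt_surv : ∀ (e : {e : G.E // S e}) x, H.tgt (ψ (Sum.inl e)) = φ x ↔ G.tgt e.1 = x := by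
    intro e x
    rw [surv_tgt e ((htgt _).2 (Or.inl e.2)), φ.apply_eq_iff_eq, Subtype.ext_iff]
  have src_new : ∀ x, H.src (ψ (Sum.inr ())) = φ x ↔ G.src eIn = x := by
    intro x
    rw [new_src ((hsrc _).2 (Or.inr rfl)), φ.apply_eq_iff_eq, Subtype.ext_iff]
  have tgt_new : ∀ x, H.tgt (ψ (Sum.inr ())) = φ x ↔ G.tgt eOut = x := by
    intro x
    rw [new_tgt ((htgt _).2 (Or.inr rfl)), φ.apply_eq_iff_eq, Subtype.ext_iff]
  have hout : ∀ x, H.outCard (φ x) = G.outCard x := fun x =>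
    card_filter_merge ψ hS_in (fun e he => (hsrc e).1 (he ▸ x.2)) (fun e => src_surv e x)
      (src_new x)
  have hin : ∀ x, H.inCard (φ x) = G.inCard x := fun x =>
    card_filter_merge ψ hS_out (fun e he => (htgt e).1 (he ▸ x.2)) (fun e => tgt_surv e x)
      (tgt_new x)
  have hside : ∀ x s, H.sideCard (φ x) s = G.sideCard x s := fun x s =>
    congrArg₂ (· + ·)
      (card_filter_merge ψ hS_in (fun e he => (hsrc e).1 (he.1 ▸ x.2))
        (fun e => by rw [src_surv, surv_sSide]) (by rw [src_new, new_sSide]))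
      (card_filter_merge ψ hS_out (fun e he => (htgt e).1 (he.1 ▸ x.2))
        (fun e => by rw [tgt_surv, surv_tSide]) (by rw [tgt_new, new_tSide]))
  obtain ⟨hreal, hempty, hlabel⟩ := hG
  refine ⟨fun v hv => ?_, fun v hv => ?_, fun e => ?_⟩
  · obtain ⟨x, rfl⟩ := φ.surjective v
    rw [hin, hout, hside, hside]
    exact hreal x (map_real x ▸ hv)
  · obtain ⟨x, rfl⟩ := φ.surjective v
    rw [hin, hout]
    exact hempty x (map_real x ▸ hv)
  · obtain ⟨e | ⟨⟩, rfl⟩ := ψ.surjective e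
    · rw [surv_sSide, surv_tSide, surv_src e ((hsrc _).2 (Or.inl e.2)),
        surv_tgt e ((htgt _).2 (Or.inl e.2)), map_real, map_real]
      exact hlabel e
    · rw [new_sSide, new_tSide, new_src ((hsrc _).2 (Or.inr rfl)),
        new_tgt ((htgt _).2 (Or.inr rfl)), map_real, map_real]
      exact ⟨(hlabel eIn).1, (hlabel eOut).2⟩

theorem Step1Data.isKEG {G H : PreKEG} (D : Step1Data G H) (hG : G.IsKEG) : H.IsKEG := by
  obtain ⟨hin, hout⟩ := hG.2.1 D.w D.hw
  have hsrc : ∀ e, G.src e = D.w ↔ e = D.eOut := fun e =>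
    ⟨eq_of_card_filter_eq_one hout D.hOut, fun h => h ▸ D.hOut⟩
  have htgt : ∀ e, G.tgt e = D.w ↔ e = D.eIn := fun e =>
    ⟨eq_of_card_filter_eq_one hin D.hIn, fun h => h ▸ D.hIn⟩
  have hne := D.hne
  refine isKEG_of_merge hG (by simp) (by simp) ?_ ?_ D.φ D.ψ D.map_real D.surv_src D.surv_tgt
    D.surv_sSide D.surv_tSide (fun _ => D.new_src) (fun _ => D.new_tgt) D.new_sSide D.new_tSide
  · intro e
    rw [ne_eq, hsrc]
    grind
  · intro e
    rw [ne_eq, htgt]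
    grind

theorem Step2Data.isKEG {G H : PreKEG} (D : Step2Data G H) (hG : G.IsKEG) : H.IsKEG := by
  obtain ⟨hin, hout, -⟩ := hG.1 D.u D.hu
  have loop_ne_in : D.loop ≠ D.eIn := fun h => D.hsrcIn (h ▸ D.hloopSrc)
  have loop_ne_out : D.loop ≠ D.eOut := fun h => D.htgtOut (h ▸ D.hloopTgt)
  have in_ne_out : D.eIn ≠ D.eOut := fun h => D.hsrcIn (h ▸ D.hOut)
  have hsrc : ∀ e, G.src e = D.u ↔ e = D.loop ∨ e = D.eOut := fun e =>
    ⟨eq_or_eq_of_card_filter_eq_two hout loop_ne_out D.hloopSrc D.hOut, by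
      rintro (rfl | rfl)
      exacts [D.hloopSrc, D.hOut]⟩
  have htgt : ∀ e, G.tgt e = D.u ↔ e = D.loop ∨ e = D.eIn := fun e =>
    ⟨eq_or_eq_of_card_filter_eq_two hin loop_ne_in D.hloopTgt D.hIn, by
      rintro (rfl | rfl)
      exacts [D.hloopTgt, D.hIn]⟩
  refine isKEG_of_merge hG (by simp) (by simp) ?_ ?_ D.φ D.ψ D.map_real D.surv_src D.surv_tgt
    D.surv_sSide D.surv_tSide (fun _ => D.new_src) (fun _ => D.new_tgt) D.new_sSide D.new_tSide
  · intro e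
    rw [ne_eq, hsrc]
    grind
  · intro e
    rw [ne_eq, htgt]
    grind

theorem card_filter_or_of_ne {E V : Type*} [Fintype E] [DecidableEq V] (f : E → V) {u v : V}
    (huv : u ≠ v) : (Finset.univ.filter fun e => f e = u ∨ f e = v).card =
      (Finset.univ.filter fun e => f e = u).card + (Finset.univ.filter fun e => f e = v).card := by
  classical
  rw [Finset.filter_or, Finset.card_union_of_disjoint]
  exact Finset.disjoint_filter.2 fun e _ h h' => huv (h.symm.trans h')

theorem Step3Data.isKEG {G H : PreKEG} (D : Step3Data G H) (hG : G.IsKEG) : H.IsKEG := by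
  obtain ⟨hreal, hempty, hlabel⟩ := hG
  have huv := D.huv
  have src_old : ∀ e x, H.src (D.ψ e) = D.φ (Sum.inl x) ↔ G.src e.1 = x := by
    intro e x
    have := x.2
    by_cases h1 : G.src e.1 = D.u
    · rw [(D.src_u e h1).1]; simp; grind
    by_cases h2 : G.src e.1 = D.v
    · rw [(D.src_v e h2).1]; simp; grind
    rw [(D.surv_src e h1 h2).1]
    simp [Subtype.ext_iff]
  have tgt_old : ∀ e x, H.tgt (D.ψ e) = D.φ (Sum.inl x) ↔ G.tgt e.1 = x := by
    intro e x
    have := x.2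
    by_cases h1 : G.tgt e.1 = D.u
    · rw [(D.tgt_u e h1).1]; simp; grind
    by_cases h2 : G.tgt e.1 = D.v
    · rw [(D.tgt_v e h2).1]; simp; grind
    rw [(D.surv_tgt e h1 h2).1]
    simp [Subtype.ext_iff]
  have src_side_old : ∀ e (x : {x : G.V // x ≠ D.u ∧ x ≠ D.v}) s,
      (H.src (D.ψ e) = D.φ (Sum.inl x) ∧ H.sSide (D.ψ e) = s) ↔
        (G.src e.1 = x ∧ G.sSide e.1 = s) := by
    intro e x s
    rw [src_old]
    refine and_congr_right fun h => ?_
    rw [(D.surv_src e (h ▸ x.2.1) (h ▸ x.2.2)).2]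
  have tgt_side_old : ∀ e (x : {x : G.V // x ≠ D.u ∧ x ≠ D.v}) s,
      (H.tgt (D.ψ e) = D.φ (Sum.inl x) ∧ H.tSide (D.ψ e) = s) ↔
        (G.tgt e.1 = x ∧ G.tSide e.1 = s) := by
    intro e x s
    rw [tgt_old]
    refine and_congr_right fun h => ?_
    rw [(D.surv_tgt e (h ▸ x.2.1) (h ▸ x.2.2)).2]
  have src_cases : ∀ e : {e : G.E // e ≠ D.d₁ ∧ e ≠ D.d₂},
      (H.src (D.ψ e) = D.φ (Sum.inr ()) ↔ G.src e.1 = D.u ∨ G.src e.1 = D.v) ∧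
      (H.src (D.ψ e) = D.φ (Sum.inr ()) ∧ H.sSide (D.ψ e) = KSide.A ↔ G.src e.1 = D.u) ∧
      (H.src (D.ψ e) = D.φ (Sum.inr ()) ∧ H.sSide (D.ψ e) = KSide.B ↔ G.src e.1 = D.v) := by
    intro e
    by_cases h1 : G.src e.1 = D.u
    · simp [D.src_u e h1, h1, huv]
    by_cases h2 : G.src e.1 = D.v
    · simp [D.src_v e h2, h2, huv.symm]
    simp [D.surv_src e h1 h2, h1, h2]
  have tgt_cases : ∀ e : {e : G.E // e ≠ D.d₁ ∧ e ≠ D.d₂},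
      (H.tgt (D.ψ e) = D.φ (Sum.inr ()) ↔ G.tgt e.1 = D.u ∨ G.tgt e.1 = D.v) ∧
      (H.tgt (D.ψ e) = D.φ (Sum.inr ()) ∧ H.tSide (D.ψ e) = KSide.A ↔ G.tgt e.1 = D.u) ∧
      (H.tgt (D.ψ e) = D.φ (Sum.inr ()) ∧ H.tSide (D.ψ e) = KSide.B ↔ G.tgt e.1 = D.v) := by
    intro e
    by_cases h1 : G.tgt e.1 = D.u
    · simp [D.tgt_u e h1, h1, huv]
    by_cases h2 : G.tgt e.1 = D.v
    · simp [D.tgt_v e h2, h2, huv.symm]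
    simp [D.surv_tgt e h1 h2, h1, h2]
  have ends₁ : (G.src D.d₁ = D.u ∧ G.tgt D.d₁ = D.v) ∨ (G.src D.d₁ = D.v ∧ G.tgt D.d₁ = D.u) :=
    D.hj₁.imp (fun h => ⟨h.1, h.2.1⟩) (fun h => ⟨h.1, h.2.1⟩)
  have ends₂ : (G.src D.d₂ = D.u ∧ G.tgt D.d₂ = D.v) ∨ (G.src D.d₂ = D.v ∧ G.tgt D.d₂ = D.u) :=
    D.hj₂.imp (fun h => ⟨h.1, h.2.1⟩) (fun h => ⟨h.1, h.2.1⟩)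
  have src_ne : ∀ x : {x : G.V // x ≠ D.u ∧ x ≠ D.v}, G.src D.d₁ ≠ x ∧ G.src D.d₂ ≠ x := by
    intro x
    have := x.2
    grind
  have tgt_ne : ∀ x : {x : G.V // x ≠ D.u ∧ x ≠ D.v}, G.tgt D.d₁ ≠ x ∧ G.tgt D.d₂ ≠ x := by
    intro x
    have := x.2
    grind
  have hout : ∀ x, H.outCard (D.φ (Sum.inl x)) = G.outCard x := fun x => by
    simpa [outCard, src_ne x] using card_filter_remove_two D.hd D.ψ
      (p := fun e => G.src e = x) (q := fun e => H.src e = D.φ (Sum.inl x)) fun e => src_old e x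
  have hin : ∀ x, H.inCard (D.φ (Sum.inl x)) = G.inCard x := fun x => by
    simpa [inCard, tgt_ne x] using card_filter_remove_two D.hd D.ψ
      (p := fun e => G.tgt e = x) (q := fun e => H.tgt e = D.φ (Sum.inl x)) fun e => tgt_old e x
  have hside : ∀ x s, H.sideCard (D.φ (Sum.inl x)) s = G.sideCard x s := fun x s => by
    have hs := card_filter_remove_two D.hd D.ψ (p := fun e => G.src e = x ∧ G.sSide e = s)
      (q := fun e => H.src e = D.φ (Sum.inl x) ∧ H.sSide e = s) fun e => src_side_old e x s
    have ht := card_filter_remove_two D.hd D.ψ (p := fun e => G.tgt e = x ∧ G.tSide e = s)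
      (q := fun e => H.tgt e = D.φ (Sum.inl x) ∧ H.tSide e = s) fun e => tgt_side_old e x s
    simp only [src_ne x, tgt_ne x, false_and, if_false, add_zero] at hs ht
    exact congrArg₂ (· + ·) hs ht
  refine ⟨fun y hy => ?_, fun y hy => ?_, fun e => ?_⟩
  · obtain ⟨x | ⟨⟩, rfl⟩ := D.φ.surjective y
    · rw [hin, hout, hside, hside]
      exact hreal x (D.map_real x ▸ hy)
    · obtain ⟨uin, uout, -⟩ := hreal D.u D.hu
      obtain ⟨vin, vout, -⟩ := hreal D.v D.hv
      have ho := card_filter_remove_two D.hd D.ψ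
        (p := fun e => G.src e = D.u ∨ G.src e = D.v)
        (q := fun e => H.src e = D.φ (Sum.inr ())) fun e => (src_cases e).1
      have hi := card_filter_remove_two D.hd D.ψ
        (p := fun e => G.tgt e = D.u ∨ G.tgt e = D.v)
        (q := fun e => H.tgt e = D.φ (Sum.inr ())) fun e => (tgt_cases e).1
      have hoA := card_filter_remove_two D.hd D.ψ
        (p := fun e => G.src e = D.u)
        (q := fun e => H.src e = D.φ (Sum.inr ()) ∧ H.sSide e = KSide.A)
        fun e => (src_cases e).2.1
      have hiA := card_filter_remove_two D.hd D.ψ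
        (p := fun e => G.tgt e = D.u)
        (q := fun e => H.tgt e = D.φ (Sum.inr ()) ∧ H.tSide e = KSide.A)
        fun e => (tgt_cases e).2.1
      have hoB := card_filter_remove_two D.hd D.ψ
        (p := fun e => G.src e = D.v)
        (q := fun e => H.src e = D.φ (Sum.inr ()) ∧ H.sSide e = KSide.B)
        fun e => (src_cases e).2.2
      have hiB := card_filter_remove_two D.hd D.ψ
        (p := fun e => G.tgt e = D.v)
        (q := fun e => H.tgt e = D.φ (Sum.inr ()) ∧ H.tSide e = KSide.B)
        fun e => (tgt_cases e).2.2
      rw [card_filter_or_of_ne _ huv] at ho hi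
      change H.inCard (D.φ (Sum.inr ())) = 2 ∧ H.outCard (D.φ (Sum.inr ())) = 2 ∧
        H.sideCard (D.φ (Sum.inr ())) KSide.A = 2 ∧ H.sideCard (D.φ (Sum.inr ())) KSide.B = 2
      simp only [inCard, outCard, sideCard] at uin uout vin vout ⊢
      rcases ends₁ with ⟨h1, h2⟩ | ⟨h1, h2⟩ <;> rcases ends₂ with ⟨h3, h4⟩ | ⟨h3, h4⟩ <;>
        simp only [h1, h2, h3, h4, huv, huv.symm, or_true, true_or, if_true, if_false]
          at ho hi hoA hiA hoB hiB <;>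
        omega
  · obtain ⟨x | ⟨⟩, rfl⟩ := D.φ.surjective y
    · rw [hin, hout]
      exact hempty x (D.map_real x ▸ hy)
    · simp [D.new_real] at hy
  · obtain ⟨e, rfl⟩ := D.ψ.surjective e
    constructor
    · by_cases h1 : G.src e.1 = D.u
      · simp [D.src_u e h1, D.new_real]
      by_cases h2 : G.src e.1 = D.v
      · simp [D.src_v e h2, D.new_real]
      rw [(D.surv_src e h1 h2).1, (D.surv_src e h1 h2).2, D.map_real]
      exact (hlabel e).1
    · by_cases h1 : G.tgt e.1 = D.u
      · simp [D.tgt_u e h1, D.new_real]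
      by_cases h2 : G.tgt e.1 = D.v
      · simp [D.tgt_v e h2, D.new_real]
      rw [(D.surv_tgt e h1 h2).1, (D.surv_tgt e h1 h2).2, D.map_real]
      exact (hlabel e).2

end PreKEG

/-- Each reduction step preserves the class of knot Eulerian
graphs: if `H` is obtained from a knot Eulerian graph `G` by Step 1 (deletion
of an empty vertex), Step 2 (an RI⁻ move) or Step 3 (a unification of two real
vertices), then `H` is again a knot Eulerian graph, i.e., every real vertex of
`H` has exactly two incoming and two outgoing edges with two edge-ends on each
of the sides `A` and `B`, every empty vertex of `H` has exactly one incoming and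
one outgoing edge with ends labeled "None", and the side labels of every edge
tuple `(u, v, T_u, T_v)` are consistent with the kinds of its endpoints. -/
theorem step_preserves_IsKEG (G H : PreKEG) (hG : G.IsKEG) (h : G.Step H) :
    H.IsKEG := by
  rcases h with ⟨⟨D⟩⟩ | ⟨⟨D⟩⟩ | ⟨⟨D⟩⟩
  exacts [D.isKEG hG, D.isKEG hG, D.isKEG hG]
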